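/- arXiv:1405.2878 — 4 statements merged into one kernel-verified Lean document; each statement's English description precedes it below -/
import Mathlib

section
/- For a single CPI-type step π_{k+1} = (1−α_{k+1})π_k + α_{k+1}π'_{k+1}, the componentwise inequality v_{π*} − v_{π_{k+1}} ≤ [(1−α_{k+1})I + α_{k+1}γP_{π*}] (v_{π*} − v_{π_k}) + α_{k+1} (I − γP_{π_{k+1}})^{−1} e_{k+1} holds. -/
open Finset Matrix

noncomputable section

/-- Transition matrix of a deterministic stationary policy. -/
def polMat {S A : Type*} (P : S → A → S → ℝ) (π : S → A) : Matrix S S ℝ :=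
  Matrix.of fun s s' => P s (π s) s'

/-- Bellman operator `T_π v = r + γ P_π v` of a deterministic stationary policy. -/
def bOp {S A : Type*} [Fintype S] (P : S → A → S → ℝ) (γ : ℝ) (r : S → ℝ)
    (π : S → A) (v : S → ℝ) : S → ℝ :=
  fun s => r s + γ * ∑ s' : S, P s (π s) s' * v s'

/-- `errOf P γ r v π = max_{π'} T_{π'} v − T_π v` (componentwise maximum over all
deterministic stationary policies `π'`). -/
def errOf {S A : Type*} [Fintype S] [Fintype A] [DecidableEq S] [Nonempty A]
    (P : S → A → S → ℝ) (γ : ℝ) (r : S → ℝ) (v : S → ℝ) (π : S → A) : S → ℝ :=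
  fun s => (Finset.univ.sup' Finset.univ_nonempty fun π' : S → A => bOp P γ r π' v s)
    - bOp P γ r π v s

/-- Values of the PSDP∞ non-stationary policies: `vSig P γ r πseq k = v_{σ_k}
= T_{π_k} T_{π_{k-1}} ⋯ T_{π_1} r` (so `vSig P γ r πseq 0 = r`). -/
def vSig {S A : Type*} [Fintype S] (P : S → A → S → ℝ) (γ : ℝ) (r : S → ℝ)
    (πseq : ℕ → S → A) : ℕ → S → ℝ
  | 0 => r
  | k+1 => bOp P γ r (πseq (k+1)) (vSig P γ r πseq k)


/-- Transition matrix of a stochastic stationary policy: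
`P_π(s,s') = Σ_a π(a|s) P(s'|s,a)`. -/
def polMatS {S A : Type*} [Fintype A] (P : S → A → S → ℝ) (π : S → A → ℝ) :
    Matrix S S ℝ :=
  Matrix.of fun s s' => ∑ a : A, π s a * P s a s'

/-- Bellman operator of a stochastic stationary policy. -/
def bOpS {S A : Type*} [Fintype S] [Fintype A] (P : S → A → S → ℝ) (γ : ℝ) (r : S → ℝ)
    (π : S → A → ℝ) (v : S → ℝ) : S → ℝ :=
  fun s => r s + γ * ∑ s' : S, (∑ a : A, π s a * P s a s') * v s'

/-- A deterministic policy viewed as a stochastic one. -/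
def detPol {S A : Type*} [DecidableEq A] (π : S → A) : S → A → ℝ :=
  fun s a => if a = π s then 1 else 0

/-- Per-state mixture `(1−α)π + απ'` of two stochastic policies. -/
def mixPol {S A : Type*} (α : ℝ) (π π' : S → A → ℝ) : S → A → ℝ :=
  fun s a => (1 - α) * π s a + α * π' s a

/-- `π` is a stochastic stationary policy. -/
def isStoch {S A : Type*} [Fintype A] (π : S → A → ℝ) : Prop :=
  (∀ s a, 0 ≤ π s a) ∧ ∀ s, ∑ a : A, π s a = 1

/-- The CPI sequence `π_0`, `π_i = (1−α_i)π_{i−1} + α_i π'_i`. -/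
def cpiSeq {S A : Type*} [DecidableEq A] (π0 : S → A → ℝ) (αf : ℕ → ℝ)
    (π'f : ℕ → S → A) : ℕ → S → A → ℝ
  | 0 => π0
  | i+1 => mixPol (αf (i+1)) (cpiSeq π0 αf π'f i) (detPol (π'f (i+1)))

/-- Comparison principle for a discounted stochastic matrix. -/
theorem nonneg_of_discounted_mulVec_le {S : Type*} [Fintype S]
    {Q : Matrix S S ℝ} (hQ0 : ∀ s t, 0 ≤ Q s t) (hQ1 : ∀ s, ∑ t, Q s t = 1)
    {γ : ℝ} (hγ0 : 0 ≤ γ) (hγ1 : γ < 1) {x : S → ℝ}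
    (hx : ∀ s, γ * (Q *ᵥ x) s ≤ x s) (s : S) : 0 ≤ x s := by
  have : Nonempty S := ⟨s⟩
  obtain ⟨m, hm⟩ := Finite.exists_min x
  have hmean : x m ≤ (Q *ᵥ x) m := calc
    x m = ∑ t, Q m t * x m := by rw [← Finset.sum_mul, hQ1, one_mul]
    _ ≤ (Q *ᵥ x) m :=
      Finset.sum_le_sum fun t _ => mul_le_mul_of_nonneg_left (hm t) (hQ0 m t)
  refine le_trans ?_ (hm s)
  nlinarith [hx m, mul_le_mul_of_nonneg_left hmean hγ0]

theorem isUnit_one_sub_smul_of_stochastic {S : Type*} [Fintype S] [DecidableEq S]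
    {Q : Matrix S S ℝ} (hQ0 : ∀ s t, 0 ≤ Q s t) (hQ1 : ∀ s, ∑ t, Q s t = 1)
    {γ : ℝ} (hγ0 : 0 ≤ γ) (hγ1 : γ < 1) : IsUnit (1 - γ • Q) := by
  rw [← Matrix.mulVec_injective_iff_isUnit]
  refine (injective_iff_map_eq_zero (1 - γ • Q).mulVecLin).2 fun x hx => ?_
  have hfix : ∀ s, x s - γ * (Q *ᵥ x) s = 0 := fun s => by
    simpa [Matrix.sub_mulVec, Matrix.smul_mulVec] using congrFun hx s
  funext s
  have hpos := nonneg_of_discounted_mulVec_le hQ0 hQ1 hγ0 hγ1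
    (x := x) (fun t => by linarith [hfix t]) s
  have hneg := nonneg_of_discounted_mulVec_le hQ0 hQ1 hγ0 hγ1
    (x := -x) (fun t => by simp only [Matrix.mulVec_neg, Pi.neg_apply]; linarith [hfix t]) s
  simp only [Pi.neg_apply] at hneg
  simp only [Pi.zero_apply]
  linarith

theorem bOpS_eq_mulVec {S A : Type*} [Fintype S] [Fintype A] (P : S → A → S → ℝ) (γ : ℝ)
    (r : S → ℝ) (π : S → A → ℝ) (v : S → ℝ) (s : S) :
    bOpS P γ r π v s = r s + γ * (polMatS P π *ᵥ v) s := rfl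

theorem bOpS_eq_sum {S A : Type*} [Fintype S] [Fintype A] (P : S → A → S → ℝ) (γ : ℝ)
    (r : S → ℝ) {π : S → A → ℝ} (hπ : isStoch π) (v : S → ℝ) (s : S) :
    bOpS P γ r π v s = ∑ a, π s a * bOp P γ r (fun _ => a) v s := by
  simp only [bOpS, bOp, mul_add, Finset.sum_add_distrib, ← Finset.sum_mul, hπ.2 s, one_mul]
  simp only [Finset.sum_mul, Finset.mul_sum]
  rw [Finset.sum_comm]
  congr 1
  exact Finset.sum_congr rfl fun _ _ => Finset.sum_congr rfl fun _ _ => by ring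

theorem bOpS_mixPol_detPol {S A : Type*} [Fintype S] [Fintype A] [DecidableEq A]
    (P : S → A → S → ℝ) (γ : ℝ) (r : S → ℝ) (α : ℝ) (π : S → A → ℝ) (π' : S → A)
    (v : S → ℝ) (s : S) :
    bOpS P γ r (mixPol α π (detPol π')) v s =
      (1 - α) * bOpS P γ r π v s + α * bOp P γ r π' v s := by
  have hrow : ∀ s', ∑ a, mixPol α π (detPol π') s a * P s a s' =
      (1 - α) * ∑ a, π s a * P s a s' + α * P s (π' s) s' := fun s' => by
    simp [mixPol, detPol, add_mul, Finset.sum_add_distrib, Finset.mul_sum, mul_assoc]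
  simp only [bOpS, bOp, hrow, add_mul, Finset.sum_add_distrib, mul_assoc, ← Finset.mul_sum]
  ring

theorem isStoch_mixPol_detPol {S A : Type*} [Fintype A] [DecidableEq A]
    {α : ℝ} (hα0 : 0 ≤ α) (hα1 : α ≤ 1) {π : S → A → ℝ} (hπ : isStoch π) (π' : S → A) :
    isStoch (mixPol α π (detPol π')) := by
  refine ⟨fun s a => add_nonneg (mul_nonneg (by linarith) (hπ.1 s a))
    (mul_nonneg hα0 ?_), fun s => ?_⟩
  · unfold detPol; split_ifs <;> norm_num
  · simp [mixPol, detPol, Finset.sum_add_distrib, ← Finset.mul_sum, hπ.2 s]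

theorem polMatS_nonneg {S A : Type*} [Fintype A] {P : S → A → S → ℝ}
    (hP0 : ∀ s a s', 0 ≤ P s a s') {π : S → A → ℝ} (hπ : isStoch π) (s t : S) :
    0 ≤ polMatS P π s t :=
  Finset.sum_nonneg fun a _ => mul_nonneg (hπ.1 s a) (hP0 s a t)

theorem sum_polMatS {S A : Type*} [Fintype S] [Fintype A] {P : S → A → S → ℝ}
    (hP1 : ∀ s a, ∑ s' : S, P s a s' = 1) {π : S → A → ℝ} (hπ : isStoch π) (s : S) :
    ∑ t, polMatS P π s t = 1 := by
  simp only [polMatS, Matrix.of_apply]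
  rw [Finset.sum_comm]
  simp [← Finset.mul_sum, hP1, hπ.2 s]

/-- The greedy Bellman operator dominates that of every stochastic policy. -/
theorem bOpS_le_bOp_add_errOf {S A : Type*} [Fintype S] [Fintype A] [DecidableEq S]
    [Nonempty A] (P : S → A → S → ℝ) (γ : ℝ) (r : S → ℝ) {π : S → A → ℝ}
    (hπ : isStoch π) (π' : S → A) (v : S → ℝ) (s : S) :
    bOpS P γ r π v s ≤ bOp P γ r π' v s + errOf P γ r v π' s := by
  rw [bOpS_eq_sum P γ r hπ, errOf, add_sub_cancel]
  set M := Finset.univ.sup' Finset.univ_nonempty fun π' : S → A => bOp P γ r π' v s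
  calc ∑ a, π s a * bOp P γ r (fun _ => a) v s
      ≤ ∑ a, π s a * M := Finset.sum_le_sum fun a _ => mul_le_mul_of_nonneg_left
        (Finset.le_sup' (fun π' : S → A => bOp P γ r π' v s) (Finset.mem_univ fun _ => a))
        (hπ.1 s a)
    _ = M := by rw [← Finset.sum_mul, hπ.2 s, one_mul]

theorem bOp_le_bOp_add_errOf {S A : Type*} [Fintype S] [Fintype A] [DecidableEq S]
    [Nonempty A] (P : S → A → S → ℝ) (γ : ℝ) (r : S → ℝ) (π π' : S → A) (v : S → ℝ) (s : S) :
    bOp P γ r π v s ≤ bOp P γ r π' v s + errOf P γ r v π' s := by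
  rw [errOf, add_sub_cancel]
  exact Finset.le_sup' (fun π' : S → A => bOp P γ r π' v s) (Finset.mem_univ π)

/-- for a single CPI-type step `π_{k+1} = (1−α_{k+1})π_k + α_{k+1}π'_{k+1}`,
componentwise `v_{π*} − v_{π_{k+1}} ≤ [(1−α_{k+1})I + α_{k+1}γP_{π*}] (v_{π*} − v_{π_k})
+ α_{k+1} (I − γP_{π_{k+1}})^{−1} e_{k+1}`. -/
theorem stmt11
    {S A : Type*} [Fintype S] [Fintype A] [DecidableEq S] [DecidableEq A]
    [Nonempty S] [Nonempty A]
    (P : S → A → S → ℝ) (hP0 : ∀ s a s', 0 ≤ P s a s')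
    (hP1 : ∀ s a, ∑ s' : S, P s a s' = 1)
    (γ : ℝ) (hγ0 : 0 < γ) (hγ1 : γ < 1)
    (Rmax Vmax : ℝ) (r : S → ℝ) (hr : ∀ s, |r s| ≤ Rmax)
    (hVmax : Vmax = Rmax / (1 - γ))
    (πstar : S → A) (vstar : S → ℝ)
    (hfix : bOp P γ r πstar vstar = vstar)
    (hopt : ∀ (π : S → A) (v : S → ℝ), bOp P γ r π v = v → ∀ s, v s ≤ vstar s)
    (πk : S → A → ℝ) (hπk : isStoch πk)
    (π' : S → A) (α : ℝ) (hα0 : 0 ≤ α) (hα1 : α ≤ 1)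
    (vk : S → ℝ) (hvk : bOpS P γ r πk vk = vk)
    (vk1 : S → ℝ) (hvk1 : bOpS P γ r (mixPol α πk (detPol π')) vk1 = vk1) :
    ∀ s, vstar s - vk1 s ≤
      ((1 - α) • (1 : Matrix S S ℝ) + (α * γ) • polMat P πstar).mulVec
          (fun t => vstar t - vk t) s
        + α * ((1 - γ • polMatS P (mixPol α πk (detPol π')))⁻¹).mulVec
            (errOf P γ r vk π') s := by
  have hmix := isStoch_mixPol_detPol hα0 hα1 hπk π'
  set Q := polMatS P (mixPol α πk (detPol π')) with hQ
  have hQ0 : ∀ s t, 0 ≤ Q s t := polMatS_nonneg hP0 hmix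
  have hQ1 : ∀ s, ∑ t, Q s t = 1 := sum_polMatS hP1 hmix
  set e := errOf P γ r vk π'
  set w := (1 - γ • Q)⁻¹ *ᵥ e with hw
  have hwfix : ∀ s, w s = e s + γ * (Q *ᵥ w) s := by
    have hdet := (Matrix.isUnit_iff_isUnit_det _).1
      (isUnit_one_sub_smul_of_stochastic hQ0 hQ1 hγ0.le hγ1)
    have hmul : (1 - γ • Q) *ᵥ w = e := by
      rw [hw, Matrix.mulVec_mulVec, Matrix.mul_nonsing_inv _ hdet, Matrix.one_mulVec]
    intro s
    have := congrFun hmul s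
    simp only [Matrix.sub_mulVec, Matrix.one_mulVec, Matrix.smul_mulVec, Pi.sub_apply,
      Pi.smul_apply, smul_eq_mul] at this
    linarith
  -- the greedy advantage of `vk`
  let g : S → ℝ := fun s => bOp P γ r π' vk s + e s - vk s
  have hg0 : ∀ s, 0 ≤ g s := fun s => by
    have := bOpS_le_bOp_add_errOf P γ r hπk π' vk s
    rw [hvk] at this
    exact sub_nonneg.2 this
  have hstep : ∀ s, r s + γ * (Q *ᵥ vk) s = vk s + α * (g s - e s) := fun s => by
    have := bOpS_mixPol_detPol P γ r α πk π' vk s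
    rw [hvk, bOpS_eq_mulVec] at this
    rw [this]
    simp only [g]
    ring
  have himprove : ∀ s, 0 ≤ (vk1 - vk - α • g + α • w) s := by
    refine nonneg_of_discounted_mulVec_le hQ0 hQ1 hγ0.le hγ1 fun s => ?_
    have hgQ : 0 ≤ (Q *ᵥ g) s := Finset.sum_nonneg fun t _ => mul_nonneg (hQ0 s t) (hg0 t)
    have hk1 := congrFun hvk1 s
    rw [bOpS_eq_mulVec, ← hQ] at hk1
    simp only [Matrix.mulVec_add, Matrix.mulVec_sub, Matrix.mulVec_smul, Pi.add_apply,
      Pi.sub_apply, Pi.smul_apply, smul_eq_mul]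
    have hnn : 0 ≤ γ * (α * (Q *ᵥ g) s) := mul_nonneg hγ0.le (mul_nonneg hα0 hgQ)
    linear_combination hnn - hstep s + hk1 - α * hwfix s
  intro s
  have hgstar : vstar s - vk s - γ * (polMat P πstar *ᵥ fun t => vstar t - vk t) s ≤ g s := by
    have hle := bOp_le_bOp_add_errOf P γ r πstar π' vk s
    have hdiff : bOp P γ r πstar vstar s - bOp P γ r πstar vk s =
        γ * (polMat P πstar *ᵥ fun t => vstar t - vk t) s := by
      simp only [bOp, polMat, Matrix.mulVec, dotProduct, Matrix.of_apply, mul_sub,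
        Finset.sum_sub_distrib]
      ring
    rw [hfix] at hdiff
    simp only [g]
    linarith
  have hx := himprove s
  simp only [Pi.add_apply, Pi.sub_apply, Pi.smul_apply, smul_eq_mul] at hx
  simp only [Matrix.add_mulVec, Matrix.smul_mulVec, Matrix.one_mulVec, Pi.add_apply,
    Pi.smul_apply, smul_eq_mul]
  linear_combination hx + α * hgstar
end
end

section
/- Let (π_i)_{i≥0} be a CPI sequence: π_0 an arbitrary stochastic policy and π_{i} = (1−α_i)π_{i−1} + α_i π'_i for i ≥ 1, with steps α_i ∈ [0,1] and deterministic policies π'_i. Suppose d_{π_{i−1},ν} e_i ≤ ε_i for 1 ≤ i ≤ k with ε_i ≥ 0, and that C^{(1,0)} := (1−γ)Σ_{l=0}^∞ γ^l c(l) is finite. Then μ(v_{π*} − v_{π_k}) ≤ (C^{(1,0)}/(1−γ)^2) Σ_{i=1}^{k} α_i ε_i + e^{−(1−γ)Σ_{i=1}^{k}α_i} · 2Vmax. -/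
open Finset Matrix

noncomputable section

/-- An action at each state maximizing the expectation of `f` at the next state. -/
def greedyPol {S A : Type*} [Fintype S] [Finite A] [Nonempty A] (P : S → A → S → ℝ)
    (f : S → ℝ) (s : S) : A :=
  (Finite.exists_max fun a => ∑ s', P s a s' * f s').choose

/-- The largest expectation of `f` at the next state, over all actions. -/
def greedyVal {S A : Type*} [Fintype S] [Finite A] [Nonempty A] (P : S → A → S → ℝ)
    (f : S → ℝ) : S → ℝ :=
  polMat P (greedyPol P f) *ᵥ f

section Stochastic

variable {S : Type*} [Fintype S]

theorem mulVec_mono_of_nonneg {Q : Matrix S S ℝ} (hQ : ∀ i j, 0 ≤ Q i j) {x y : S → ℝ}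
    (h : x ≤ y) : Q *ᵥ x ≤ Q *ᵥ y :=
  fun i => Finset.sum_le_sum fun j _ => mul_le_mul_of_nonneg_left (h j) (hQ i j)

variable [DecidableEq S]

theorem mulVec_const_of_mem_rowStochastic {Q : Matrix S S ℝ} (hQ : Q ∈ rowStochastic ℝ S)
    (b : ℝ) : (Q *ᵥ fun _ => b) = fun _ => b := by
  have h : (fun _ : S => b) = b • (1 : S → ℝ) := by ext; simp
  rw [h, mulVec_smul, (mem_rowStochastic.1 hQ).2]

variable {γ : ℝ}

/-- Maximum principle for a discounted stochastic matrix. -/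
theorem nonpos_of_le_discounted_mulVec (hγ0 : 0 ≤ γ) (hγ1 : γ < 1) {Q : Matrix S S ℝ}
    (hQ : Q ∈ rowStochastic ℝ S) {x : S → ℝ} (h : ∀ s, x s ≤ γ * (Q *ᵥ x) s) (s : S) :
    x s ≤ 0 := by
  have : Nonempty S := ⟨s⟩
  obtain ⟨m, hm⟩ := Finite.exists_max x
  have h1 : (Q *ᵥ x) m ≤ x m := by
    have := mulVec_mono_of_nonneg (mem_rowStochastic.1 hQ).1 (x := x) (y := fun _ => x m) hm m
    rwa [mulVec_const_of_mem_rowStochastic hQ] at this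
  have h2 := h m
  have h3 := mul_le_mul_of_nonneg_left h1 hγ0
  have h4 := hm s
  nlinarith

theorem isUnit_one_sub_discounted (hγ0 : 0 ≤ γ) (hγ1 : γ < 1) {Q : Matrix S S ℝ}
    (hQ : Q ∈ rowStochastic ℝ S) : IsUnit (1 - γ • Q) := by
  rw [← mulVec_injective_iff_isUnit]
  intro x y hxy
  have h : ∀ s, x s - y s = γ * (Q *ᵥ (x - y)) s := fun s => by
    have := congrFun hxy s
    simp only [sub_mulVec, one_mulVec, smul_mulVec, Pi.sub_apply, Pi.smul_apply,
      smul_eq_mul, mulVec_sub] at this ⊢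
    linarith
  have h1 := nonpos_of_le_discounted_mulVec hγ0 hγ1 hQ (x := x - y) fun s => (h s).le
  have h2 := nonpos_of_le_discounted_mulVec hγ0 hγ1 hQ (x := -(x - y)) fun s => by
    rw [mulVec_neg]
    simp only [Pi.neg_apply, Pi.sub_apply]
    rw [h s]
    linarith
  ext s
  have h1 := h1 s
  have h2 := h2 s
  simp only [Pi.neg_apply, Pi.sub_apply] at h1 h2
  linarith

theorem resolvent_mulVec_eq (hγ0 : 0 ≤ γ) (hγ1 : γ < 1) {Q : Matrix S S ℝ}
    (hQ : Q ∈ rowStochastic ℝ S) (e : S → ℝ) (s : S) :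
    ((1 - γ • Q)⁻¹ *ᵥ e) s = e s + γ * (Q *ᵥ ((1 - γ • Q)⁻¹ *ᵥ e)) s := by
  have h : (1 - γ • Q) *ᵥ ((1 - γ • Q)⁻¹ *ᵥ e) = e := by
    rw [mulVec_mulVec, mul_nonsing_inv _
      ((isUnit_iff_isUnit_det _).1 (isUnit_one_sub_discounted hγ0 hγ1 hQ)), one_mulVec]
  have := congrFun h s
  rw [sub_mulVec, one_mulVec, smul_mulVec] at this
  simp only [Pi.sub_apply, Pi.smul_apply, smul_eq_mul] at this
  linarith

theorem le_resolvent_mulVec (hγ0 : 0 ≤ γ) (hγ1 : γ < 1) {Q : Matrix S S ℝ}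
    (hQ : Q ∈ rowStochastic ℝ S) {e : S → ℝ} (he : ∀ s, 0 ≤ e s) (s : S) :
    e s ≤ ((1 - γ • Q)⁻¹ *ᵥ e) s := by
  set w := (1 - γ • Q)⁻¹ *ᵥ e
  have hfix : ∀ s, w s = e s + γ * (Q *ᵥ w) s := resolvent_mulVec_eq hγ0 hγ1 hQ e
  have h0 : ∀ s, (-w) s ≤ 0 := nonpos_of_le_discounted_mulVec hγ0 hγ1 hQ fun s => by
    rw [mulVec_neg, Pi.neg_apply, Pi.neg_apply, hfix s]
    linarith [he s]
  have h1 := mulVec_mono_of_nonneg (mem_rowStochastic.1 hQ).1 (x := 0) (y := w)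
    (fun s => by simpa using h0 s) s
  rw [mulVec_zero] at h1
  rw [hfix s]
  linarith [mul_nonneg hγ0 h1]

theorem le_of_bellman_fixed (hγ0 : 0 ≤ γ) (hγ1 : γ < 1) {Q : Matrix S S ℝ}
    (hQ : Q ∈ rowStochastic ℝ S) {r v : S → ℝ} {R : ℝ} (hr : ∀ s, r s ≤ R)
    (hv : ∀ s, v s = r s + γ * (Q *ᵥ v) s) (s : S) : v s ≤ R / (1 - γ) := by
  have hR : R = (1 - γ) * (R / (1 - γ)) := by
    field_simp [(sub_pos.2 hγ1).ne']
  have := nonpos_of_le_discounted_mulVec hγ0 hγ1 hQ (x := v - fun _ => R / (1 - γ)) (fun s => by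
    rw [mulVec_sub, mulVec_const_of_mem_rowStochastic hQ]
    simp only [Pi.sub_apply]
    linarith [hv s, hr s]) s
  simpa using this

theorem abs_le_of_bellman_fixed (hγ0 : 0 ≤ γ) (hγ1 : γ < 1) {Q : Matrix S S ℝ}
    (hQ : Q ∈ rowStochastic ℝ S) {r v : S → ℝ} {R : ℝ} (hr : ∀ s, |r s| ≤ R)
    (hv : ∀ s, v s = r s + γ * (Q *ᵥ v) s) (s : S) : |v s| ≤ R / (1 - γ) := by
  rw [abs_le']
  refine ⟨le_of_bellman_fixed hγ0 hγ1 hQ (fun s => (abs_le'.1 (hr s)).1) hv s, ?_⟩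
  refine le_of_bellman_fixed hγ0 hγ1 hQ (r := -r) (v := -v)
    (fun s => (abs_le'.1 (hr s)).2) (fun s => ?_) s
  rw [mulVec_neg, Pi.neg_apply, Pi.neg_apply, Pi.neg_apply, hv s]
  ring

/-- Lower bound on the value improvement `y` of a policy whose advantage is `α (g - e)`. -/
theorem sub_resolvent_le_improvement (hγ0 : 0 ≤ γ) (hγ1 : γ < 1) {Q : Matrix S S ℝ}
    (hQ : Q ∈ rowStochastic ℝ S) {α : ℝ} (hα : 0 ≤ α) {y g e : S → ℝ} (hg : ∀ s, 0 ≤ g s)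
    (hy : ∀ s, y s = γ * (Q *ᵥ y) s + α * (g s - e s)) (s : S) :
    α * g s - α * ((1 - γ • Q)⁻¹ *ᵥ e) s ≤ y s := by
  set u := (1 - γ • Q)⁻¹ *ᵥ e
  have hfix : ∀ s, u s = e s + γ * (Q *ᵥ u) s := resolvent_mulVec_eq hγ0 hγ1 hQ e
  have := nonpos_of_le_discounted_mulVec hγ0 hγ1 hQ (x := α • g - α • u - y) (fun s => by
    have h1 := mulVec_mono_of_nonneg (mem_rowStochastic.1 hQ).1 (x := 0) (y := g) hg s
    rw [mulVec_zero] at h1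
    simp only [mulVec_sub, mulVec_smul, Pi.sub_apply, Pi.smul_apply, smul_eq_mul]
    rw [hy s, hfix s]
    nlinarith [mul_nonneg (mul_nonneg hγ0 hα) h1]) s
  simp only [Pi.sub_apply, Pi.smul_apply, smul_eq_mul] at this
  linarith

end Stochastic

section Policies

theorem bOp_apply {S A : Type*} [Fintype S] (P : S → A → S → ℝ)
    (γ : ℝ) (r : S → ℝ) (π : S → A) (v : S → ℝ) (s : S) :
    bOp P γ r π v s = r s + γ * (polMat P π *ᵥ v) s := rfl

variable {S A : Type*} [Fintype A]

theorem polMatS_detPol [DecidableEq A] (P : S → A → S → ℝ) (π : S → A) :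
    polMatS P (detPol π) = polMat P π := by
  ext s s'
  simp [polMatS, detPol, polMat]

theorem polMatS_mixPol (P : S → A → S → ℝ) (α : ℝ) (π π' : S → A → ℝ) :
    polMatS P (mixPol α π π') = (1 - α) • polMatS P π + α • polMatS P π' := by
  ext s s'
  simp [polMatS, mixPol, add_mul, Finset.sum_add_distrib, Finset.mul_sum, mul_assoc]

theorem isStoch_detPol [DecidableEq A] (π : S → A) : isStoch (detPol π) :=
  ⟨fun s a => by unfold detPol; split_ifs <;> norm_num, fun s => by simp [detPol]⟩

theorem isStoch_mixPol {α : ℝ} (h0 : 0 ≤ α) (h1 : α ≤ 1) {π π' : S → A → ℝ}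
    (hπ : isStoch π) (hπ' : isStoch π') : isStoch (mixPol α π π') :=
  ⟨fun s a => add_nonneg (mul_nonneg (by linarith) (hπ.1 s a)) (mul_nonneg h0 (hπ'.1 s a)),
    fun s => by
      simp [mixPol, Finset.sum_add_distrib, ← Finset.mul_sum, hπ.2 s, hπ'.2 s]⟩

theorem isStoch_cpiSeq [DecidableEq A] {π0 : S → A → ℝ} (hπ0 : isStoch π0) {αf : ℕ → ℝ}
    (hαf : ∀ i, 1 ≤ i → 0 ≤ αf i ∧ αf i ≤ 1) (π'f : ℕ → S → A) (i : ℕ) :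
    isStoch (cpiSeq π0 αf π'f i) := by
  induction i with
  | zero => exact hπ0
  | succ i ih =>
    have h := hαf (i + 1) (by omega)
    exact isStoch_mixPol h.1 h.2 ih (isStoch_detPol _)

variable [Fintype S]

theorem bOpS_apply (P : S → A → S → ℝ) (γ : ℝ) (r : S → ℝ) (π : S → A → ℝ) (v : S → ℝ) (s : S) :
    bOpS P γ r π v s = r s + γ * (polMatS P π *ᵥ v) s := rfl

theorem polMatS_mulVec_le_greedyVal [Nonempty A] (P : S → A → S → ℝ)
    {π : S → A → ℝ} (hπ : isStoch π) (f : S → ℝ) : polMatS P π *ᵥ f ≤ greedyVal P f := fun s => by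
  have hmax : ∀ a, ∑ s', P s a s' * f s' ≤ greedyVal P f s :=
    (Finite.exists_max fun a => ∑ s', P s a s' * f s').choose_spec
  calc (polMatS P π *ᵥ f) s = ∑ a, π s a * ∑ s', P s a s' * f s' := by
        simp only [polMatS, mulVec, dotProduct, of_apply, Finset.sum_mul, Finset.mul_sum]
        rw [Finset.sum_comm]
        simp only [mul_assoc]
    _ ≤ ∑ a, π s a * greedyVal P f s :=
        Finset.sum_le_sum fun a _ => mul_le_mul_of_nonneg_left (hmax a) (hπ.1 s a)
    _ = greedyVal P f s := by rw [← Finset.sum_mul, hπ.2 s, one_mul]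

variable [DecidableEq S] {P : S → A → S → ℝ}

theorem polMatS_mem_rowStochastic (hP0 : ∀ s a s', 0 ≤ P s a s')
    (hP1 : ∀ s a, ∑ s' : S, P s a s' = 1) {π : S → A → ℝ} (hπ : isStoch π) :
    polMatS P π ∈ rowStochastic ℝ S := by
  rw [mem_rowStochastic_iff_sum]
  refine ⟨fun s s' => Finset.sum_nonneg fun a _ => mul_nonneg (hπ.1 s a) (hP0 s a s'),
    fun s => ?_⟩
  simp only [polMatS, of_apply]
  rw [Finset.sum_comm]
  simp [← Finset.mul_sum, hP1, hπ.2 s]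

variable [Nonempty A]

theorem bOpS_le_sup (P : S → A → S → ℝ) {γ : ℝ} (hγ0 : 0 ≤ γ) (r : S → ℝ) {π : S → A → ℝ}
    (hπ : isStoch π) (v : S → ℝ) (s : S) :
    bOpS P γ r π v s ≤
      Finset.univ.sup' Finset.univ_nonempty fun π' : S → A => bOp P γ r π' v s := by
  refine le_trans ?_ (Finset.le_sup' (fun π' : S → A => bOp P γ r π' v s)
    (Finset.mem_univ (greedyPol P v)))
  rw [bOpS_apply, bOp_apply]
  gcongr
  exact polMatS_mulVec_le_greedyVal P hπ v s

theorem iterate_greedyVal_eq (P : S → A → S → ℝ) (f : S → ℝ) (i : ℕ) :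
    ∃ πs : ℕ → S → A,
      (greedyVal P)^[i] f = ((List.range i).map fun t => polMat P (πs t)).prod *ᵥ f := by
  induction i with
  | zero => exact ⟨fun _ _ => Classical.arbitrary A, by simp⟩
  | succ i ih =>
    obtain ⟨πs, h⟩ := ih
    refine ⟨fun t => Nat.casesOn t (greedyPol P ((greedyVal P)^[i] f)) πs, ?_⟩
    rw [Function.iterate_succ_apply', List.range_succ_eq_map, List.map_cons, List.prod_cons,
      List.map_map, ← mulVec_mulVec]
    change polMat P _ *ᵥ _ = polMat P _ *ᵥ (((List.range i).map fun t => polMat P (πs t)).prod *ᵥ f)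
    rw [← h]
    rfl

theorem dotProduct_iterate_greedyVal_le {μ ν : S → ℝ} {c : ℕ → ℝ}
    (hc : ∀ (i : ℕ) (πs : ℕ → S → A) (s : S),
      Matrix.vecMul μ (((List.range i).map fun t => polMat P (πs t)).prod) s ≤ c i * ν s)
    {f : S → ℝ} (hf : ∀ s, 0 ≤ f s) (i : ℕ) :
    μ ⬝ᵥ (greedyVal P)^[i] f ≤ c i * (ν ⬝ᵥ f) := by
  obtain ⟨πs, h⟩ := iterate_greedyVal_eq P f i
  rw [h, dotProduct_mulVec, dotProduct, dotProduct, Finset.mul_sum]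
  refine Finset.sum_le_sum fun s _ => ?_
  rw [← mul_assoc]
  exact mul_le_mul_of_nonneg_right (hc i πs s) (hf s)

theorem polMatS_mulVec_le_sum_greedyVal (hP0 : ∀ s a s', 0 ≤ P s a s')
    (hP1 : ∀ s a, ∑ s' : S, P s a s' = 1) {π : S → A → ℝ} (hπ : isStoch π)
    {γ : ℝ} (hγ0 : 0 ≤ γ) {f x : S → ℝ} {m N : ℕ} {b : ℝ}
    (hx : ∀ s, x s ≤ ∑ l ∈ Finset.range N, γ ^ l * (greedyVal P)^[m + l] f s + b) (s : S) :
    (polMatS P π *ᵥ x) s ≤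
      ∑ l ∈ Finset.range N, γ ^ l * (greedyVal P)^[m + 1 + l] f s + b := by
  have hQ := polMatS_mem_rowStochastic hP0 hP1 hπ
  have h := mulVec_mono_of_nonneg (mem_rowStochastic.1 hQ).1
    (y := (∑ l ∈ Finset.range N, γ ^ l • (greedyVal P)^[m + l] f) + fun _ => b)
    (fun s => by simpa using hx s) s
  rw [mulVec_add, mulVec_const_of_mem_rowStochastic hQ, mulVec_sum] at h
  simp only [mulVec_smul, Pi.add_apply, Finset.sum_apply, Pi.smul_apply, smul_eq_mul] at h
  refine h.trans (add_le_add_left (Finset.sum_le_sum fun l _ => ?_) b)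
  rw [add_right_comm, Function.iterate_succ_apply']
  exact mul_le_mul_of_nonneg_left (polMatS_mulVec_le_greedyVal P hπ _ s) (pow_nonneg hγ0 l)

theorem resolvent_le_sum_greedyVal (hP0 : ∀ s a s', 0 ≤ P s a s')
    (hP1 : ∀ s a, ∑ s' : S, P s a s' = 1) {π : S → A → ℝ} (hπ : isStoch π)
    {γ : ℝ} (hγ0 : 0 ≤ γ) {e u : S → ℝ} {b : ℝ} (hb : ∀ s, u s ≤ b)
    (hu : ∀ s, u s = e s + γ * (polMatS P π *ᵥ u) s) (N : ℕ) (s : S) :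
    u s ≤ ∑ l ∈ Finset.range N, γ ^ l * (greedyVal P)^[l] e s + γ ^ N * b := by
  induction N generalizing s with
  | zero => simpa using hb s
  | succ N ih =>
    have h := polMatS_mulVec_le_sum_greedyVal hP0 hP1 hπ hγ0 (m := 0)
      (fun s => by simpa using ih s) s
    rw [hu s, Finset.sum_range_succ']
    have h2 := mul_le_mul_of_nonneg_left h hγ0
    rw [mul_add, Finset.mul_sum] at h2
    have h3 : ∀ l ∈ Finset.range N, γ * (γ ^ l * (greedyVal P)^[0 + 1 + l] e s) =
        γ ^ (l + 1) * (greedyVal P)^[l + 1] e s := fun l _ => by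
      rw [show 0 + 1 + l = l + 1 by omega]; ring
    rw [Finset.sum_congr rfl h3] at h2
    simp only [pow_zero, one_mul, Function.iterate_zero, id_eq]
    rw [pow_succ' γ N]
    linarith

theorem pow_mulVec_le_sum_greedyVal (hP0 : ∀ s a s', 0 ≤ P s a s')
    (hP1 : ∀ s a, ∑ s' : S, P s a s' = 1) {π : S → A → ℝ} (hπ : isStoch π)
    {γ : ℝ} (hγ0 : 0 ≤ γ) {f x : S → ℝ} {N : ℕ} {b : ℝ}
    (hx : ∀ s, x s ≤ ∑ l ∈ Finset.range N, γ ^ l * (greedyVal P)^[l] f s + b) (n : ℕ) (s : S) :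
    ((polMatS P π ^ n) *ᵥ x) s ≤
      ∑ l ∈ Finset.range N, γ ^ l * (greedyVal P)^[n + l] f s + b := by
  induction n generalizing s with
  | zero => simpa using hx s
  | succ n ih =>
    rw [pow_succ', ← mulVec_mulVec]
    exact polMatS_mulVec_le_sum_greedyVal hP0 hP1 hπ hγ0 ih s

/-- The concentrability coefficients bound the resolvent of any stochastic policy, preceded by
any number of discounted steps of another one. -/
theorem discounted_pow_resolvent_le (hP0 : ∀ s a s', 0 ≤ P s a s')
    (hP1 : ∀ s a, ∑ s' : S, P s a s' = 1) {γ : ℝ} (hγ0 : 0 ≤ γ) (hγ1 : γ < 1)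
    {μ ν : S → ℝ} (hμ0 : ∀ s, 0 ≤ μ s) (hμ1 : ∑ s : S, μ s = 1) (hν0 : ∀ s, 0 ≤ ν s)
    {c : ℕ → ℝ} (hc0 : ∀ i, 0 ≤ c i)
    (hc : ∀ (i : ℕ) (πs : ℕ → S → A) (s : S),
      Matrix.vecMul μ (((List.range i).map fun t => polMat P (πs t)).prod) s ≤ c i * ν s)
    (hsum : Summable fun l : ℕ => γ ^ l * c l) {π π' : S → A → ℝ} (hπ : isStoch π)
    (hπ' : isStoch π') {e : S → ℝ} (he : ∀ s, 0 ≤ e s) (n : ℕ) :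
    γ ^ n * (μ ⬝ᵥ ((polMatS P π' ^ n) *ᵥ ((1 - γ • polMatS P π)⁻¹ *ᵥ e))) ≤
      (∑' l : ℕ, γ ^ l * c l) * (ν ⬝ᵥ e) := by
  set u := (1 - γ • polMatS P π)⁻¹ *ᵥ e
  have hu := resolvent_mulVec_eq hγ0 hγ1 (polMatS_mem_rowStochastic hP0 hP1 hπ) e
  have hνe : 0 ≤ ν ⬝ᵥ e := Finset.sum_nonneg fun s _ => mul_nonneg (hν0 s) (he s)
  obtain ⟨b, hb⟩ : ∃ b, ∀ s, u s ≤ b := by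
    obtain ⟨b, hb⟩ := (Set.finite_range u).bddAbove
    exact ⟨b, fun s => hb ⟨s, rfl⟩⟩
  have hN : ∀ N : ℕ, γ ^ n * (μ ⬝ᵥ ((polMatS P π' ^ n) *ᵥ u)) ≤
      (∑' l : ℕ, γ ^ l * c l) * (ν ⬝ᵥ e) + γ ^ N * (γ ^ n * b) := fun N => by
    have h1 := pow_mulVec_le_sum_greedyVal hP0 hP1 hπ' hγ0
      (resolvent_le_sum_greedyVal hP0 hP1 hπ hγ0 hb hu N) n
    have h2 : μ ⬝ᵥ ((polMatS P π' ^ n) *ᵥ u) ≤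
        ∑ l ∈ Finset.range N, γ ^ l * (μ ⬝ᵥ (greedyVal P)^[n + l] e) + γ ^ N * b := by
      refine (Finset.sum_le_sum fun s _ => mul_le_mul_of_nonneg_left (h1 s) (hμ0 s)).trans_eq ?_
      simp only [mul_add, Finset.sum_add_distrib, ← Finset.sum_mul, hμ1, one_mul, dotProduct,
        Finset.mul_sum]
      rw [Finset.sum_comm]
      simp only [mul_left_comm]
    have h3 : γ ^ n * ∑ l ∈ Finset.range N, γ ^ l * (μ ⬝ᵥ (greedyVal P)^[n + l] e) ≤
        (∑ l ∈ Finset.range N, γ ^ (n + l) * c (n + l)) * (ν ⬝ᵥ e) := by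
      rw [Finset.mul_sum, Finset.sum_mul]
      refine Finset.sum_le_sum fun l _ => ?_
      rw [← mul_assoc, ← pow_add, mul_assoc]
      exact mul_le_mul_of_nonneg_left (dotProduct_iterate_greedyVal_le hc he (n + l))
        (pow_nonneg hγ0 _)
    have hnn : ∀ l, 0 ≤ γ ^ l * c l := fun l => mul_nonneg (pow_nonneg hγ0 l) (hc0 l)
    have h4 : ∑ l ∈ Finset.range N, γ ^ (n + l) * c (n + l) ≤ ∑' l : ℕ, γ ^ l * c l := by
      have h5 := hsum.sum_le_tsum (Finset.range (n + N)) fun l _ => hnn l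
      rw [Finset.sum_range_add] at h5
      linarith [Finset.sum_nonneg fun l (_ : l ∈ Finset.range n) => hnn l]
    have h6 := mul_le_mul_of_nonneg_left h2 (pow_nonneg hγ0 n)
    have h7 := mul_le_mul_of_nonneg_right h4 hνe
    linarith
  have hlim : Filter.Tendsto
      (fun N : ℕ => (∑' l : ℕ, γ ^ l * c l) * (ν ⬝ᵥ e) + γ ^ N * (γ ^ n * b)) Filter.atTop
      (nhds ((∑' l : ℕ, γ ^ l * c l) * (ν ⬝ᵥ e) + 0 * (γ ^ n * b))) :=
    ((tendsto_pow_atTop_nhds_zero_of_lt_one hγ0 hγ1).mul_const _).const_add _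
  simpa using ge_of_tendsto' hlim hN

/-- One CPI step: the gap to the value of any deterministic policy `πstar`. -/
theorem gap_mixPol_le [DecidableEq A] (hP0 : ∀ s a s', 0 ≤ P s a s')
    (hP1 : ∀ s a, ∑ s' : S, P s a s' = 1) {γ : ℝ} (hγ0 : 0 ≤ γ) (hγ1 : γ < 1) {r : S → ℝ}
    {πstar : S → A} {vstar : S → ℝ} (hfix : bOp P γ r πstar vstar = vstar)
    {π : S → A → ℝ} (hπ : isStoch π) {α : ℝ} (hα0 : 0 ≤ α) (hα1 : α ≤ 1) {π' : S → A}
    {v v' : S → ℝ} (hv : bOpS P γ r π v = v)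
    (hv' : bOpS P γ r (mixPol α π (detPol π')) v' = v') (s : S) :
    vstar s - v' s ≤ (1 - α) * (vstar s - v s)
      + α * γ * (polMatS P (detPol πstar) *ᵥ (vstar - v)) s
      + α * ((1 - γ • polMatS P (mixPol α π (detPol π')))⁻¹ *ᵥ errOf P γ r v π') s := by
  have hmix := isStoch_mixPol hα0 hα1 hπ (isStoch_detPol π')
  have h := sub_resolvent_le_improvement hγ0 hγ1 (polMatS_mem_rowStochastic hP0 hP1 hmix)
    hα0 (y := v' - v) (e := errOf P γ r v π')
    (g := fun s => (Finset.univ.sup' Finset.univ_nonempty fun π'' : S → A => bOp P γ r π'' v s)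
      - v s)
    (fun s => by
      have := bOpS_le_sup P hγ0 r hπ v s
      rw [hv] at this
      exact sub_nonneg.2 this)
    (fun s => by
      have h1 := congrFun hv s
      have h2 := congrFun hv' s
      rw [bOpS_apply] at h1 h2
      simp only [errOf, bOp_apply, mulVec_sub, Pi.sub_apply]
      rw [polMatS_mixPol, polMatS_detPol] at h2 ⊢
      simp only [add_mulVec, smul_mulVec, Pi.add_apply, Pi.smul_apply, smul_eq_mul] at h2 ⊢
      linear_combination (-1) * h2 + (1 - α) * h1) s
  have h1 := bOpS_le_sup P hγ0 r (isStoch_detPol πstar) v s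
  have h2 := congrFun hfix s
  rw [bOp_apply, ← polMatS_detPol] at h2
  rw [bOpS_apply] at h1
  simp only [mulVec_sub, Pi.sub_apply] at h ⊢
  have h3 := mul_le_mul_of_nonneg_left h1 hα0
  have h4 := congrArg (fun t => α * t) h2
  linarith

theorem errOf_nonneg (P : S → A → S → ℝ) (γ : ℝ) (r v : S → ℝ) (π : S → A) (s : S) :
    0 ≤ errOf P γ r v π s :=
  sub_nonneg.2 (Finset.le_sup' (fun π' : S → A => bOp P γ r π' v s) (Finset.mem_univ π))

end Policies

/-- for a CPI sequence with `d_{π_{i−1},ν} e_i ≤ ε_i` for `1 ≤ i ≤ k` and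
`C^{(1,0)} = (1−γ)Σ_l γ^l c(l)` finite,
`μ(v_{π*} − v_{π_k}) ≤ (C^{(1,0)}/(1−γ)^2) Σ_{i=1}^{k} α_i ε_i
+ e^{−(1−γ)Σ_{i=1}^{k}α_i} · 2Vmax`. -/
theorem stmt12
    {S A : Type*} [Fintype S] [Fintype A] [DecidableEq S] [DecidableEq A]
    [Nonempty S] [Nonempty A]
    (P : S → A → S → ℝ) (hP0 : ∀ s a s', 0 ≤ P s a s')
    (hP1 : ∀ s a, ∑ s' : S, P s a s' = 1)
    (γ : ℝ) (hγ0 : 0 < γ) (hγ1 : γ < 1)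
    (Rmax Vmax : ℝ) (r : S → ℝ) (hr : ∀ s, |r s| ≤ Rmax)
    (hVmax : Vmax = Rmax / (1 - γ))
    (πstar : S → A) (vstar : S → ℝ)
    (hfix : bOp P γ r πstar vstar = vstar)
    (hopt : ∀ (π : S → A) (v : S → ℝ), bOp P γ r π v = v → ∀ s, v s ≤ vstar s)
    (μ ν : S → ℝ) (hμ0 : ∀ s, 0 ≤ μ s) (hμ1 : ∑ s : S, μ s = 1)
    (hν0 : ∀ s, 0 ≤ ν s) (hν1 : ∑ s : S, ν s = 1)
    (c : ℕ → ℝ) (hc0 : ∀ i, 0 ≤ c i)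
    (hc : ∀ (i : ℕ) (πs : ℕ → S → A) (s : S),
      Matrix.vecMul μ (((List.range i).map fun t => polMat P (πs t)).prod) s ≤ c i * ν s)
    (hsum : Summable fun l : ℕ => γ ^ l * c l)
    (π0 : S → A → ℝ) (hπ0 : isStoch π0)
    (αf : ℕ → ℝ) (hαf : ∀ i, 1 ≤ i → 0 ≤ αf i ∧ αf i ≤ 1)
    (π'f : ℕ → S → A)
    (vS : ℕ → S → ℝ)
    (hvS : ∀ i : ℕ, bOpS P γ r (cpiSeq π0 αf π'f i) (vS i) = vS i)
    (k : ℕ) (εf : ℕ → ℝ) (hεf0 : ∀ i, 0 ≤ εf i)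
    (herr : ∀ i, 1 ≤ i → i ≤ k →
      (∑ s : S, ((1 - γ) • Matrix.vecMul ν
          (1 - γ • polMatS P (cpiSeq π0 αf π'f (i - 1)))⁻¹) s
        * errOf P γ r (vS (i - 1)) (π'f i) s) ≤ εf i) :
    (∑ s : S, μ s * (vstar s - vS k s)) ≤
      ((1 - γ) * ∑' l : ℕ, γ ^ l * c l) / (1 - γ) ^ 2
          * (∑ i ∈ Finset.Icc 1 k, αf i * εf i)
        + Real.exp (-(1 - γ) * ∑ i ∈ Finset.Icc 1 k, αf i) * (2 * Vmax) := by
  have hγ0' := hγ0.le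
  have hs := isStoch_cpiSeq hπ0 hαf π'f
  have hst := isStoch_detPol πstar
  have hQst := polMatS_mem_rowStochastic hP0 hP1 hst
  set C := ∑' l : ℕ, γ ^ l * c l
  have hC0 : 0 ≤ C := tsum_nonneg fun l => mul_nonneg (pow_nonneg hγ0' l) (hc0 l)
  have h1γ : 0 < 1 - γ := sub_pos.2 hγ1
  have hνe : ∀ i, i + 1 ≤ k →
      ν ⬝ᵥ errOf P γ r (vS i) (π'f (i + 1)) ≤ εf (i + 1) / (1 - γ) := fun i hi => by
    have h := herr (i + 1) (by omega) hi
    rw [Nat.add_sub_cancel] at h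
    have h' : (1 - γ) * (ν ⬝ᵥ ((1 - γ • polMatS P (cpiSeq π0 αf π'f i))⁻¹ *ᵥ
        errOf P γ r (vS i) (π'f (i + 1)))) ≤ εf (i + 1) := by
      rw [dotProduct_mulVec, ← smul_eq_mul, ← smul_dotProduct]
      exact h
    rw [le_div_iff₀' h1γ]
    refine le_trans (mul_le_mul_of_nonneg_left ?_ h1γ.le) h'
    exact Finset.sum_le_sum fun s _ => mul_le_mul_of_nonneg_left
      (le_resolvent_mulVec hγ0' hγ1 (polMatS_mem_rowStochastic hP0 hP1 (hs i))
        (errOf_nonneg P γ r _ _) s) (hν0 s)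
  have hVmax0 : 0 ≤ Vmax := by
    rw [hVmax]
    exact div_nonneg ((abs_nonneg _).trans (hr (Classical.arbitrary S))) h1γ.le
  have key : ∀ j, j ≤ k → ∃ x : S → ℝ,
      (∀ n : ℕ, γ ^ n * (μ ⬝ᵥ ((polMatS P (detPol πstar) ^ n) *ᵥ x)) ≤
        C / (1 - γ) * ∑ i ∈ Finset.Icc 1 j, αf i * εf i) ∧
      ∀ s, vstar s - vS j s ≤
        x s + Real.exp (-(1 - γ) * ∑ i ∈ Finset.Icc 1 j, αf i) * (2 * Vmax) := by
    intro j
    induction j with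
    | zero =>
      refine fun _ => ⟨0, fun n => by simp, fun s => ?_⟩
      have h1 := abs_le_of_bellman_fixed hγ0' hγ1 hQst hr
        (fun s => by rw [polMatS_detPol, ← bOp_apply, hfix]) s
      have h2 := abs_le_of_bellman_fixed hγ0' hγ1
        (polMatS_mem_rowStochastic hP0 hP1 (hs 0)) hr
        (fun s => by rw [← bOpS_apply, hvS 0]) s
      rw [← hVmax, abs_le] at h1 h2
      simp only [Pi.zero_apply, zero_add, Finset.Icc_eq_empty (show ¬ (1 ≤ 0) by omega),
        Finset.sum_empty, mul_zero, Real.exp_zero, one_mul]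
      linarith [h1.2, h2.1]
    | succ j ih =>
      intro hj
      obtain ⟨x, hx, hxv⟩ := ih (by omega)
      obtain ⟨hα0, hα1⟩ := hαf (j + 1) (by omega)
      set e := errOf P γ r (vS j) (π'f (j + 1))
      set u := (1 - γ • polMatS P (cpiSeq π0 αf π'f (j + 1)))⁻¹ *ᵥ e
      set Q := polMatS P (detPol πstar)
      set α := αf (j + 1)
      refine ⟨(1 - α) • x + (α * γ) • (Q *ᵥ x) + α • u, fun n => ?_, fun s => ?_⟩
      · have h1 := hx n
        have h2 := hx (n + 1)
        have h3 := (discounted_pow_resolvent_le hP0 hP1 hγ0' hγ1 hμ0 hμ1 hν0 hc0 hc hsum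
          (hs (j + 1)) hst (errOf_nonneg P γ r (vS j) (π'f (j + 1))) n).trans
            (mul_le_mul_of_nonneg_left (hνe j hj) hC0)
        rw [pow_succ Q, ← mulVec_mulVec, pow_succ γ] at h2
        rw [Finset.sum_Icc_succ_top (by omega)]
        simp only [mulVec_add, mulVec_smul, dotProduct_add, dotProduct_smul, smul_eq_mul]
        have g1 := mul_le_mul_of_nonneg_left h1 (sub_nonneg.2 hα1)
        have g2 := mul_le_mul_of_nonneg_left h2 hα0
        have g3 := mul_le_mul_of_nonneg_left h3 hα0
        calc _ = _ := by ring
          _ ≤ _ := add_le_add (add_le_add g1 g2) g3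
          _ = _ := by ring
      · have hgap := gap_mixPol_le hP0 hP1 hγ0' hγ1 hfix (hs j) hα0 hα1 (hvS j) (hvS (j + 1)) s
        set b := Real.exp (-(1 - γ) * ∑ i ∈ Finset.Icc 1 j, αf i) * (2 * Vmax)
        have hb0 : 0 ≤ b := by positivity
        have h1 := mulVec_mono_of_nonneg (mem_rowStochastic.1 hQst).1 (x := vstar - vS j)
          (y := x + fun _ => b) hxv s
        rw [mulVec_add, mulVec_const_of_mem_rowStochastic hQst, Pi.add_apply] at h1
        have g1 := mul_le_mul_of_nonneg_left (hxv s) (sub_nonneg.2 hα1)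
        have g2 := mul_le_mul_of_nonneg_left h1 (mul_nonneg hα0 hγ0')
        have g3 := mul_le_mul_of_nonneg_right (Real.add_one_le_exp (-(1 - γ) * α)) hb0
        rw [Finset.sum_Icc_succ_top (by omega), mul_add, Real.exp_add]
        simp only [Pi.add_apply, Pi.smul_apply, smul_eq_mul]
        have g4 : Real.exp (-(1 - γ) * ∑ i ∈ Finset.Icc 1 j, αf i) *
            Real.exp (-(1 - γ) * αf (j + 1)) * (2 * Vmax) = Real.exp (-(1 - γ) * α) * b := by
          ring
        rw [g4]
        change _ ≤ _ + _ + α * u s at hgap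
        linarith
  obtain ⟨x, hx, hxv⟩ := key k le_rfl
  have h0 := hx 0
  rw [pow_zero, pow_zero, one_mulVec, one_mul] at h0
  have hcoef : (1 - γ) * C / (1 - γ) ^ 2 = C / (1 - γ) := by
    field_simp
  rw [hcoef]
  refine (Finset.sum_le_sum fun s _ => mul_le_mul_of_nonneg_left (hxv s) (hμ0 s)).trans ?_
  simp only [mul_add, Finset.sum_add_distrib, ← Finset.sum_mul, hμ1, one_mul]
  exact add_le_add_left h0 _
end
end

section
/- For every γ ∈ (0,1), every integer m ≥ 1 and every c : ℕ → [0,∞], one has (as sums in [0,∞]) (m+1) Σ_{n=0}^∞ (1+⌊n/m⌋) γ^n c(n) ≥ Σ_{n=0}^∞ (n+1) γ^n c(n) + Σ_{n=0}^{m−1} γ^n c(n). In particular, since C^{(2,1,0)} = (1−γ)^2 Σ_{n≥0}(n+1)γ^n c(n) and C^{(2,m,0)} = (1−γ)(1−γ^m) Σ_{n≥0}(1+⌊n/m⌋)γ^n c(n), one gets C^{(2,1,0)} ≤ (m+1)(1−γ)/(1−γ^m) · C^{(2,m,0)}, so that if C^{(2,m,0)} is finite then C^{(2,1,0)} is finite.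 -/
open scoped ENNReal

noncomputable section

/-- `C^{(2,m,k)} = (1−γ)(1−γ^m) Σ_{i=0}^∞ Σ_{j=0}^∞ γ^{i+jm} c(i+jm+k)` (in `[0,∞]`). -/
def C2 (γ : ℝ≥0∞) (m k : ℕ) (c : ℕ → ℝ≥0∞) : ℝ≥0∞ :=
  (1 - γ) * (1 - γ ^ m) * ∑' i : ℕ, ∑' j : ℕ, γ ^ (i + j * m) * c (i + j * m + k)

/-- Summing `f` along all arithmetic progressions of step `m` counts `f n` once for each `j` with
`j * m ≤ n`. -/
theorem ENNReal.tsum_tsum_add_mul {m : ℕ} (hm : 0 < m) (f : ℕ → ℝ≥0∞) :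
    ∑' i : ℕ, ∑' j : ℕ, f (i + j * m) = ∑' n : ℕ, (1 + (n / m : ℕ)) * f n := by
  have shift (j : ℕ) : ∑' i : ℕ, f (i + j * m) = ∑' n : ℕ, if j * m ≤ n then f n else 0 := by
    rw [← (add_left_injective (j * m)).tsum_eq (f := fun n => if j * m ≤ n then f n else 0)]
    · simp
    · intro n hn
      have h : j * m ≤ n := by
        by_contra h
        simp [h] at hn
      exact ⟨n - j * m, Nat.sub_add_cancel h⟩
  rw [ENNReal.tsum_comm, tsum_congr shift, ENNReal.tsum_comm]
  refine tsum_congr fun n => ?_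
  rw [tsum_eq_sum (s := Finset.range (n / m + 1)) fun j hj => if_neg fun h =>
    hj (Finset.mem_range.2 (Nat.lt_succ_of_le ((Nat.le_div_iff_mul_le hm).2 h)))]
  rw [Finset.sum_congr rfl fun j hj => if_pos ((Nat.le_div_iff_mul_le hm).1
    (Nat.le_of_lt_succ (Finset.mem_range.1 hj)))]
  simp [add_comm]

theorem C2_zero_eq (γ : ℝ≥0∞) {m : ℕ} (hm : 0 < m) (c : ℕ → ℝ≥0∞) :
    C2 γ m 0 c = (1 - γ) * (1 - γ ^ m) * ∑' n : ℕ, (1 + (n / m : ℕ)) * γ ^ n * c n := by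
  simp only [C2, add_zero, mul_assoc]
  rw [ENNReal.tsum_tsum_add_mul hm fun n => γ ^ n * c n]

theorem add_one_add_ite_le_mul_one_add_div {m : ℕ} (hm : 0 < m) (n : ℕ) :
    n + 1 + (if n < m then 1 else 0) ≤ (m + 1) * (1 + n / m) := by
  have hdiv := Nat.div_add_mod n m
  have hmod := Nat.mod_lt n hm
  split_ifs with h
  · rw [Nat.div_eq_of_lt h]
    lia
  · nlinarith

theorem tsum_add_sum_range_le_mul_tsum_div {m : ℕ} (hm : 0 < m) (f : ℕ → ℝ≥0∞) :
    ∑' n : ℕ, ((n : ℝ≥0∞) + 1) * f n + ∑ n ∈ Finset.range m, f n ≤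
      (m + 1) * ∑' n : ℕ, (1 + (n / m : ℕ)) * f n := by
  have hsum : ∑ n ∈ Finset.range m, f n = ∑' n : ℕ, ((if n < m then 1 else 0 : ℕ) : ℝ≥0∞) * f n := by
    rw [tsum_eq_sum (s := Finset.range m) fun n hn => by simp [Finset.mem_range.not.1 hn]]
    exact Finset.sum_congr rfl fun n hn => by simp [Finset.mem_range.1 hn]
  rw [hsum, ← ENNReal.tsum_add, ← ENNReal.tsum_mul_left]
  refine ENNReal.tsum_le_tsum fun n => ?_
  rw [← add_mul, ← mul_assoc]
  gcongr
  exact_mod_cast add_one_add_ite_le_mul_one_add_div hm n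

/-- for every `γ ∈ (0,1)`, integer `m ≥ 1` and `c : ℕ → [0,∞]`,
`(m+1) Σ_n (1+⌊n/m⌋) γ^n c(n) ≥ Σ_n (n+1) γ^n c(n) + Σ_{n=0}^{m−1} γ^n c(n)`;
in particular `C^{(2,1,0)} ≤ (m+1)(1−γ)/(1−γ^m) · C^{(2,m,0)}`, so that if
`C^{(2,m,0)}` is finite then `C^{(2,1,0)}` is finite. -/
theorem stmt18 (γ : ℝ≥0∞) (hγ0 : 0 < γ) (hγ1 : γ < 1)
    (m : ℕ) (hm : 1 ≤ m) (c : ℕ → ℝ≥0∞) :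
    (∑' n : ℕ, ((n : ℝ≥0∞) + 1) * γ ^ n * c n + ∑ n ∈ Finset.range m, γ ^ n * c n ≤
      (m + 1) * ∑' n : ℕ, (1 + (n / m : ℕ)) * γ ^ n * c n)
    ∧ C2 γ 1 0 c ≤ (m + 1) * (1 - γ) / (1 - γ ^ m) * C2 γ m 0 c
    ∧ (C2 γ m 0 c < ⊤ → C2 γ 1 0 c < ⊤) := by
  have main := tsum_add_sum_range_le_mul_tsum_div hm fun n => γ ^ n * c n
  simp only [← mul_assoc] at main
  have hpos : 1 - γ ^ m ≠ 0 :=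
    (tsub_pos_of_lt (pow_lt_one₀ hγ0.le hγ1 (Nat.one_le_iff_ne_zero.1 hm))).ne'
  have hfin : 1 - γ ^ m ≠ ⊤ := ENNReal.sub_ne_top ENNReal.one_ne_top
  have bound : C2 γ 1 0 c ≤ (m + 1) * (1 - γ) / (1 - γ ^ m) * C2 γ m 0 c := by
    rw [C2_zero_eq γ one_pos, C2_zero_eq γ hm]
    set S := ∑' n : ℕ, (1 + ((n / m : ℕ) : ℝ≥0∞)) * γ ^ n * c n
    calc (1 - γ) * (1 - γ ^ 1) * ∑' n : ℕ, (1 + ((n / 1 : ℕ) : ℝ≥0∞)) * γ ^ n * c n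
        = (1 - γ) * (1 - γ) * ∑' n : ℕ, ((n : ℝ≥0∞) + 1) * γ ^ n * c n := by
          simp only [pow_one, Nat.div_one, add_comm]
      _ ≤ (1 - γ) * (1 - γ) * ((m + 1) * S) := by
          gcongr
          exact le_self_add.trans main
      _ = (m + 1) * (1 - γ) * ((1 - γ ^ m)⁻¹ * (1 - γ ^ m)) * ((1 - γ) * S) := by
          rw [ENNReal.inv_mul_cancel hpos hfin]
          ring
      _ = (m + 1) * (1 - γ) / (1 - γ ^ m) * ((1 - γ) * (1 - γ ^ m) * S) := by
          rw [div_eq_mul_inv]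
          ring
  refine ⟨main, bound, fun h => bound.trans_lt (ENNReal.mul_lt_top ?_ h)⟩
  refine ENNReal.div_lt_top (ENNReal.mul_ne_top ?_ (ENNReal.sub_ne_top ENNReal.one_ne_top)) hpos
  exact_mod_cast ENNReal.natCast_ne_top (m + 1)
end
end

section
/- Let γ ∈ (0,1) and let m ≥ 1 be an integer. Define c : ℕ → [1,∞) by c(0) = 1 and c(n) = max(1, 1/(n^2 γ^n)) for n ≥ 1. Then the series Σ_{i=0}^∞ γ^i c(i+m) converges, while the double series Σ_{i=0}^∞ Σ_{j=0}^∞ γ^{i+jm} c(i+(j+1)m) diverges to ∞. Hence C^{(1,m)} = (1−γ)Σ_{i≥0}γ^i c(i+m) is finite while C^{(2,m,m)} = (1−γ)(1−γ^m)Σ_{i,j≥0}γ^{i+jm}c(i+jm+m) is infinite: finiteness of C^{(1,m)} does not imply finiteness of C^{(2,m,m)}. -/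
noncomputable section

/-- The double series `∑ 1 / (i + j + 1) ^ 2` diverges: its antidiagonal sums are harmonic. -/
theorem not_summable_one_div_add_add_one_sq :
    ¬ Summable (fun p : ℕ × ℕ => 1 / ((p.1 : ℝ) + p.2 + 1) ^ 2) := by
  intro h
  have h_sigma :=
    ((Finset.HasAntidiagonal.sigmaAntidiagonalEquivProd (A := ℕ)).summable_iff.mpr h).sigma
  refine Real.not_summable_one_div_natCast ((summable_nat_add_iff 1).mp (h_sigma.congr ?_))
  intro n
  have h_fiber : ∀ x : Finset.HasAntidiagonal.antidiagonal n,
      ((fun p : ℕ × ℕ => 1 / ((p.1 : ℝ) + p.2 + 1) ^ 2) ∘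
        Finset.HasAntidiagonal.sigmaAntidiagonalEquivProd)
        ⟨n, x⟩ = 1 / ((n : ℝ) + 1) ^ 2 := by
    rintro ⟨⟨a, b⟩, hx⟩
    have hab : (a : ℝ) + b = n := by exact_mod_cast Finset.HasAntidiagonal.mem_antidiagonal.mp hx
    simp [Finset.HasAntidiagonal.sigmaAntidiagonalEquivProd, hab]
  have hn : (n : ℝ) + 1 ≠ 0 := by positivity
  rw [tsum_congr h_fiber, tsum_fintype]
  simp only [Finset.sum_const, Finset.card_univ, Fintype.card_coe,
    Finset.Nat.card_antidiagonal, nsmul_eq_mul]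
  push_cast
  field_simp

/-- let `γ ∈ (0,1)`, `m ≥ 1`, and `c : ℕ → [1,∞)` with `c 0 = 1` and
`c n = max 1 (1/(n^2 γ^n))` for `n ≥ 1`. Then `Σ_{i=0}^∞ γ^i c(i+m)` converges, while the
double series `Σ_{i,j≥0} γ^{i+jm} c(i+(j+1)m)` diverges to ∞ (is not summable). Hence
`C^{(1,m)} = (1−γ)Σ_i γ^i c(i+m)` is finite while
`C^{(2,m,m)} = (1−γ)(1−γ^m)Σ_{i,j} γ^{i+jm} c(i+jm+m)` is infinite. -/
theorem stmt19 (γ : ℝ) (hγ0 : 0 < γ) (hγ1 : γ < 1)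
    (m : ℕ) (hm : 1 ≤ m) (c : ℕ → ℝ)
    (hc0 : c 0 = 1)
    (hc : ∀ n : ℕ, 1 ≤ n → c n = max 1 (1 / ((n : ℝ) ^ 2 * γ ^ n))) :
    Summable (fun i : ℕ => γ ^ i * c (i + m))
    ∧ ¬ Summable (fun p : ℕ × ℕ => γ ^ (p.1 + p.2 * m) * c (p.1 + (p.2 + 1) * m)) := by
  have hγm : 0 < γ ^ m := pow_pos hγ0 m
  have h_term : ∀ n : ℕ, γ ^ n * c (n + m) =
      max (γ ^ n) ((γ ^ m)⁻¹ * (1 / ((n + m : ℕ) : ℝ) ^ 2)) := by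
    intro n
    have hnm : ((n + m : ℕ) : ℝ) ≠ 0 := by
      exact_mod_cast (by omega : n + m ≠ 0)
    rw [hc (n + m) (by omega), mul_max_of_nonneg _ _ (pow_pos hγ0 n).le, mul_one, pow_add γ n m]
    congr 1
    field_simp
  constructor
  · refine Summable.of_nonneg_of_le (fun n => ?_) (fun n => ?_)
      ((summable_geometric_of_lt_one hγ0.le hγ1).add
        (((summable_nat_add_iff m).mpr
          (Real.summable_one_div_nat_pow.mpr one_lt_two)).mul_left (γ ^ m)⁻¹))
    · rw [h_term]
      exact le_max_of_le_left (pow_pos hγ0 n).le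
    · rw [h_term]
      exact max_le_add_of_nonneg (pow_pos hγ0 n).le (by positivity)
  · intro h
    refine not_summable_one_div_add_add_one_sq
      (Summable.of_nonneg_of_le (fun p => by positivity) (fun p => ?_) (h.mul_left ((m : ℝ) ^ 2)))
    obtain ⟨i, j⟩ := p
    have h_index : i + (j + 1) * m = i + j * m + m := by ring
    have hm1 : (1 : ℝ) ≤ m := by exact_mod_cast hm
    have h_le : ((i + j * m + m : ℕ) : ℝ) ≤ m * ((i : ℝ) + j + 1) := by
      push_cast
      nlinarith [mul_nonneg (Nat.cast_nonneg (α := ℝ) i) (sub_nonneg.mpr hm1)]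
    have h_pos : (0 : ℝ) < ((i + j * m + m : ℕ) : ℝ) := by
      exact_mod_cast (by omega : 0 < i + j * m + m)
    simp only [h_index, h_term]
    calc 1 / ((i : ℝ) + j + 1) ^ 2
        = (m : ℝ) ^ 2 * (1 / (m * ((i : ℝ) + j + 1)) ^ 2) := by
          field_simp
      _ ≤ (m : ℝ) ^ 2 * (1 / ((i + j * m + m : ℕ) : ℝ) ^ 2) := by gcongr
      _ ≤ (m : ℝ) ^ 2 * ((γ ^ m)⁻¹ * (1 / ((i + j * m + m : ℕ) : ℝ) ^ 2)) := by
          gcongr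
          exact le_mul_of_one_le_left (by positivity)
            ((one_le_inv₀ hγm).mpr (pow_le_one₀ hγ0.le hγ1.le))
      _ ≤ _ := by
          gcongr
          exact le_max_right _ _
end
end
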